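/- Let H be a complex Hilbert space. Let D : H → H be a bounded self-adjoint invertible operator, ψ ∈ H a unit vector with D ψ = λ_D • ψ for some real λ_D < 0, and ω > 0 such that Re ⟪D v, v⟫ ≥ ω ‖v‖² for every v orthogonal to ψ. Let 0 < β₋ ≤ β₊, let f : ℝ → ℝ be continuous with β₋ ≤ f(t) ≤ β₊ for all t ∈ ℝ, and let λ > −β₋ be real. Let φ ∈ H satisfy that ⟪φ, ψ⟫ is a positive real number γ, set φ⊥ := φ − γ • ψ and C₀ := ((β₊ + λ)/((β₋ + λ) γ))² · Re ⟪D⁻¹ φ⊥, φ⊥⟫, and assume |λ_D| · C₀ ≤ 1/2. Then every u ∈ H satisfying the constraint ⟪u, D⁻¹((cfc f D) + λ I) φ⟫ = 0 obeys Re ⟪D⁻¹ u, u⟫ ≥ (1/(2 β₊)) · Re ⟪(cfc f D)(D⁻¹ u), u⟫. -/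

import Mathlib

open scoped InnerProductSpace

section helpers
variable {H : Type*} [NormedAddCommGroup H] [InnerProductSpace ℂ H] [CompleteSpace H]

lemma aux_symm {A : H →L[ℂ] H} (hA : IsSelfAdjoint A) (x y : H) :
    ⟪A x, y⟫_ℂ = ⟪x, A y⟫_ℂ :=
  hA.isSymmetric x y

lemma aux_comm {D : H →L[ℂ] H} (hD : IsSelfAdjoint D) (g : ℝ → ℝ) (x : H) :
    cfc g D (D x) = D (cfc g D x) := by
  have h := cfc_commute_cfc g (id : ℝ → ℝ) D
  rw [cfc_id ℝ D] at h
  exact congrArg (fun A : H →L[ℂ] H => A x) h.eq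

lemma aux_eig {D : H →L[ℂ] H} (hD : IsSelfAdjoint D)
    {ψ : H} (hψ : ‖ψ‖ = 1) {lamD : ℝ} (hlamD : lamD < 0) (hDψ : D ψ = (lamD : ℂ) • ψ)
    {ω : ℝ} (hω : 0 < ω)
    (hgap : ∀ v : H, ⟪ψ, v⟫_ℂ = 0 → ω * ‖v‖ ^ 2 ≤ (⟪v, D v⟫_ℂ).re) (g : ℝ → ℝ) :
    cfc g D ψ = ⟪ψ, cfc g D ψ⟫_ℂ • ψ := by
  have hψψ : ⟪ψ, ψ⟫_ℂ = 1 := by rw [inner_self_eq_norm_sq_to_K, hψ]; simp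
  set v := cfc g D ψ - ⟪ψ, cfc g D ψ⟫_ℂ • ψ with hv
  have h1 : ⟪ψ, v⟫_ℂ = 0 := by simp [hv, inner_sub_right, inner_smul_right, hψ]
  have h2 : D v = (lamD : ℂ) • v := by
    rw [hv, map_sub, map_smul, ← aux_comm hD, hDψ, map_smul, smul_sub, smul_comm]
  have h3 := hgap v h1
  rw [h2, inner_smul_right, inner_self_eq_norm_sq_to_K] at h3
  have h4 : ((lamD : ℂ) * ((‖v‖ : ℝ) : ℂ) ^ 2).re = lamD * ‖v‖ ^ 2 := by
    rw [← Complex.ofReal_pow, ← Complex.ofReal_mul, Complex.ofReal_re]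
  have h3' : ω * ‖v‖ ^ 2 ≤ lamD * ‖v‖ ^ 2 := by rw [← h4]; exact h3
  have h5 : v = 0 := by
    by_contra hne
    have : 0 < ‖v‖ ^ 2 := by positivity
    nlinarith
  exact sub_eq_zero.mp h5

lemma aux_perp {D : H →L[ℂ] H} (hD : IsSelfAdjoint D)
    {ψ : H} (hψ : ‖ψ‖ = 1) {lamD : ℝ} (hlamD : lamD < 0) (hDψ : D ψ = (lamD : ℂ) • ψ)
    {ω : ℝ} (hω : 0 < ω)
    (hgap : ∀ v : H, ⟪ψ, v⟫_ℂ = 0 → ω * ‖v‖ ^ 2 ≤ (⟪v, D v⟫_ℂ).re) (g : ℝ → ℝ)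
    (w : H) (hw : ⟪ψ, w⟫_ℂ = 0) : ⟪ψ, cfc g D w⟫_ℂ = 0 := by
  rw [← aux_symm (cfc_predicate g D), aux_eig hD hψ hlamD hDψ hω hgap g, inner_smul_left, hw,
    mul_zero]

lemma aux_pos {D : H →L[ℂ] H} (hD : IsSelfAdjoint D)
    {ψ : H} (hψ : ‖ψ‖ = 1) {lamD : ℝ} (hlamD : lamD < 0) (hDψ : D ψ = (lamD : ℂ) • ψ)
    {ω : ℝ} (hω : 0 < ω)
    (hgap : ∀ v : H, ⟪ψ, v⟫_ℂ = 0 → ω * ‖v‖ ^ 2 ≤ (⟪v, D v⟫_ℂ).re) (g : ℝ → ℝ)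
    (hg : Continuous g) (hg0 : ∀ t, 0 ≤ g t)
    (w : H) (hw : ⟪ψ, w⟫_ℂ = 0) : 0 ≤ (⟪D w, cfc g D w⟫_ℂ).re := by
  have h1 : cfc g D = cfc (fun t => √(g t)) D * cfc (fun t => √(g t)) D := by
    rw [← cfc_mul (fun t => √(g t)) (fun t => √(g t)) D (by fun_prop) (by fun_prop)]
    congr 1
    ext t
    exact (Real.mul_self_sqrt (hg0 t)).symm
  rw [h1, ContinuousLinearMap.mul_apply, ← aux_symm (cfc_predicate _ D), aux_comm hD,
    aux_symm hD]
  exact le_trans (by positivity)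
    (hgap _ (aux_perp hD hψ hlamD hDψ hω hgap (fun t => √(g t)) w hw))

lemma aux_low {D : H →L[ℂ] H} (hD : IsSelfAdjoint D) (g : ℝ → ℝ)
    (hg : Continuous g) (hg0 : ∀ t, 0 ≤ g t) (w : H) : 0 ≤ (⟪w, cfc g D w⟫_ℂ).re := by
  have h1 : cfc g D = cfc (fun t => √(g t)) D * cfc (fun t => √(g t)) D := by
    rw [← cfc_mul (fun t => √(g t)) (fun t => √(g t)) D (by fun_prop) (by fun_prop)]
    congr 1
    ext t
    exact (Real.mul_self_sqrt (hg0 t)).symm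
  rw [h1, ContinuousLinearMap.mul_apply, ← aux_symm (cfc_predicate _ D)]
  exact inner_self_nonneg (𝕜 := ℂ)

lemma aux_cs {D : H →L[ℂ] H} (hD : IsSelfAdjoint D) {ψ : H}
    (hpos : ∀ v : H, ⟪ψ, v⟫_ℂ = 0 → 0 ≤ (⟪v, D v⟫_ℂ).re)
    (x y : H) (hx : ⟪ψ, x⟫_ℂ = 0) (hy : ⟪ψ, y⟫_ℂ = 0) :
    Complex.normSq ⟪x, D y⟫_ℂ ≤ (⟪x, D x⟫_ℂ).re * (⟪y, D y⟫_ℂ).re := by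
  set z := ⟪x, D y⟫_ℂ with hz
  have hz' : ⟪y, D x⟫_ℂ = (starRingEnd ℂ) z := by
    rw [hz, inner_conj_symm, aux_symm hD]
  have key : ∀ t : ℝ, 0 ≤ (Complex.normSq z * (⟪y, D y⟫_ℂ).re) * (t * t)
      + (2 * Complex.normSq z) * t + (⟪x, D x⟫_ℂ).re := by
    intro t
    have h := hpos (x + ((t : ℂ) * (starRingEnd ℂ) z) • y)
      (by rw [inner_add_right, inner_smul_right, hx, hy]; simp)
    have e : ⟪x + ((t : ℂ) * (starRingEnd ℂ) z) • y,
        D (x + ((t : ℂ) * (starRingEnd ℂ) z) • y)⟫_ℂ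
        = ⟪x, D x⟫_ℂ + 2 * t * (z * (starRingEnd ℂ) z)
          + t * t * (z * (starRingEnd ℂ) z) * ⟪y, D y⟫_ℂ := by
      simp only [map_add, map_smul, inner_add_left, inner_add_right, inner_smul_left,
        inner_smul_right, ← hz, hz', map_mul, Complex.conj_ofReal, Complex.conj_conj]
      ring
    rw [e, Complex.mul_conj] at h
    have e2 : (⟪x, D x⟫_ℂ + 2 * t * (Complex.normSq z : ℂ)
          + t * t * (Complex.normSq z : ℂ) * ⟪y, D y⟫_ℂ).re =
        (Complex.normSq z * (⟪y, D y⟫_ℂ).re) * (t * t)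
      + (2 * Complex.normSq z) * t + (⟪x, D x⟫_ℂ).re := by
      simp
      ring
    rw [e2] at h
    exact h
  have hd := discrim_le_zero key
  unfold discrim at hd
  rcases (Complex.normSq_nonneg z).eq_or_lt with h0 | h0
  · rw [← h0]; exact mul_nonneg (hpos x hx) (hpos y hy)
  · have : Complex.normSq z * (Complex.normSq z) ≤
        Complex.normSq z * ((⟪x, D x⟫_ℂ).re * (⟪y, D y⟫_ℂ).re) := by nlinarith
    exact le_of_mul_le_mul_left this h0

lemma aux_const_sub {D : H →L[ℂ] H} (hD : IsSelfAdjoint D) (r : ℝ) (g : ℝ → ℝ)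
    (hg : Continuous g) :
    cfc (fun t => r - g t) D = algebraMap ℝ (H →L[ℂ] H) r - cfc g D := by
  rw [cfc_sub (fun _ => r) g D (by fun_prop) (by fun_prop), cfc_const r D]

end helpers

/-- Lemma 2.6 (DDC-lower): with `D` bounded self-adjoint invertible, negative ground
state `D ψ = lamD • ψ` (`‖ψ‖ = 1`, `lamD < 0`), spectral gap `Re ⟪D v, v⟫ ≥ ω ‖v‖²`
on `{ψ}⊥` (`ω > 0`), a continuous `f : ℝ → ℝ` with `βlo ≤ f ≤ βhi` (`0 < βlo ≤ βhi`),
a real `lam > -βlo`, `φ` with `⟪φ, ψ⟫ = γ > 0` (paper convention: inner product linear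
in its first argument), `φ⊥ := φ - γ • ψ`,
`C₀ := ((βhi + lam)/((βlo + lam) γ))² · Re ⟪D⁻¹ φ⊥, φ⊥⟫`, and `|lamD| · C₀ ≤ 1/2`,
every `u` with `⟪u, D⁻¹((cfc f D) + lam I) φ⟫ = 0` obeys
`Re ⟪D⁻¹ u, u⟫ ≥ (1/(2 βhi)) · Re ⟪(cfc f D)(D⁻¹ u), u⟫`. -/
theorem constrained_Dinv_ratio_lower_bound
    {H : Type*} [NormedAddCommGroup H] [InnerProductSpace ℂ H] [CompleteSpace H]
    (D Dinv : H →L[ℂ] H) (hD : IsSelfAdjoint D)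
    (hD1 : D.comp Dinv = ContinuousLinearMap.id ℂ H)
    (hD2 : Dinv.comp D = ContinuousLinearMap.id ℂ H)
    (ψ : H) (hψ : ‖ψ‖ = 1) (lamD : ℝ) (hlamD : lamD < 0) (hDψ : D ψ = lamD • ψ)
    (ω : ℝ) (hω : 0 < ω)
    (hgap : ∀ v : H, ⟪ψ, v⟫_ℂ = 0 → ω * ‖v‖ ^ 2 ≤ (⟪v, D v⟫_ℂ).re)
    (βlo βhi : ℝ) (hβlo : 0 < βlo) (hββ : βlo ≤ βhi)
    (f : ℝ → ℝ) (hf : Continuous f) (hfb : ∀ t : ℝ, βlo ≤ f t ∧ f t ≤ βhi)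
    (lam : ℝ) (hlam : -βlo < lam)
    (φ : H) (γ : ℝ) (hγ : 0 < γ) (hφψ : ⟪ψ, φ⟫_ℂ = (γ : ℂ))
    (C₀ : ℝ)
    (hC₀ : C₀ = ((βhi + lam) / ((βlo + lam) * γ)) ^ 2 *
      (⟪φ - (γ : ℂ) • ψ, Dinv (φ - (γ : ℂ) • ψ)⟫_ℂ).re)
    (hsmall : |lamD| * C₀ ≤ 1 / 2)
    (u : H)
    (hconstraint : ⟪Dinv ((cfc f D) φ + (lam : ℂ) • φ), u⟫_ℂ = 0) :
    (1 / (2 * βhi)) * (⟪u, (cfc f D) (Dinv u)⟫_ℂ).re ≤ (⟪u, Dinv u⟫_ℂ).re := by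
  have hDψ' : D ψ = (lamD : ℂ) • ψ := by rw [hDψ, Complex.coe_smul]
  have hDi : ∀ z, D (Dinv z) = z := fun z => congrArg (fun A : H →L[ℂ] H => A z) hD1
  have hiD : ∀ z, Dinv (D z) = z := fun z => congrArg (fun A : H →L[ℂ] H => A z) hD2
  have hψψ : ⟪ψ, ψ⟫_ℂ = 1 := by rw [inner_self_eq_norm_sq_to_K, hψ]; simp
  have hpos : ∀ v : H, ⟪ψ, v⟫_ℂ = 0 → 0 ≤ (⟪v, D v⟫_ℂ).re := fun v hv =>
    le_trans (by positivity) (hgap v hv)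
  have hlne : (lamD : ℂ) ≠ 0 := by exact_mod_cast hlamD.ne
  -- the shifted operator
  have hT : cfc (fun t => f t + lam) D = cfc f D + algebraMap ℝ (H →L[ℂ] H) lam := by
    rw [cfc_add_const lam f D]
  have hTap : ∀ z, cfc (fun t => f t + lam) D z = cfc f D z + (lam : ℂ) • z := by
    intro z
    rw [hT, ContinuousLinearMap.add_apply, Algebra.algebraMap_eq_smul_one,
      ContinuousLinearMap.smul_apply, ContinuousLinearMap.one_apply, Complex.coe_smul]
  set T := cfc (fun t => f t + lam) D with hTdef
  have hTs : IsSelfAdjoint T := cfc_predicate _ D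
  have hTc : ∀ z, T (D z) = D (T z) := aux_comm hD _
  set S := cfc f D with hSdef
  have hSs : IsSelfAdjoint S := cfc_predicate _ D
  have hSperp := aux_perp hD hψ hlamD hDψ' hω hgap f
  rw [← hSdef] at hSperp
  have hTperp := aux_perp hD hψ hlamD hDψ' hω hgap (fun t => f t + lam)
  rw [← hTdef] at hTperp
  -- eigenvalue of S
  obtain ⟨s, hs⟩ : ∃ s : ℝ, ⟪ψ, S ψ⟫_ℂ = (s : ℂ) := by
    refine ⟨(⟪ψ, S ψ⟫_ℂ).re, ?_⟩
    refine (Complex.conj_eq_iff_re.mp ?_).symm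
    rw [inner_conj_symm, aux_symm hSs]
  have hSψ : S ψ = (s : ℂ) • ψ := by
    rw [← hs]; exact aux_eig hD hψ hlamD hDψ' hω hgap f
  have hTψ : T ψ = ((s + lam : ℝ) : ℂ) • ψ := by
    rw [hTap, hSψ]; push_cast; rw [add_smul]
  have hslo : βlo ≤ s := by
    have h := aux_low hD (fun t => f t + (-βlo)) (by fun_prop)
      (fun t => by linarith [(hfb t).1]) ψ
    rw [cfc_add_const (-βlo) f D, ContinuousLinearMap.add_apply,
      Algebra.algebraMap_eq_smul_one,
      ContinuousLinearMap.smul_apply, ContinuousLinearMap.one_apply, ← Complex.coe_smul,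
      inner_add_right, inner_smul_right, ← hSdef, hs, hψψ] at h
    simp at h
    exact h
  -- bounds
  have hSb : ∀ w, ⟪ψ, w⟫_ℂ = 0 → (⟪D w, S w⟫_ℂ).re ≤ βhi * (⟪w, D w⟫_ℂ).re := by
    intro w hw
    have h := aux_pos hD hψ hlamD hDψ' hω hgap (fun t => βhi - f t) (by fun_prop)
      (fun t => by linarith [(hfb t).2]) w hw
    rw [aux_const_sub hD βhi f hf, ContinuousLinearMap.sub_apply,
      Algebra.algebraMap_eq_smul_one,
      ContinuousLinearMap.smul_apply, ContinuousLinearMap.one_apply, ← Complex.coe_smul,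
      inner_sub_right, inner_smul_right, ← hSdef, aux_symm hD w w, Complex.sub_re,
      Complex.re_ofReal_mul] at h
    linarith
  have hTb : ∀ w, ⟪ψ, w⟫_ℂ = 0 →
      (⟪T w, D (T w)⟫_ℂ).re ≤ (βhi + lam) ^ 2 * (⟪w, D w⟫_ℂ).re := by
    intro w hw
    have h := aux_pos hD hψ hlamD hDψ' hω hgap
      (fun t => (βhi + lam) ^ 2 - (f t + lam) * (f t + lam)) (by fun_prop)
      (fun t => by nlinarith [(hfb t).1, (hfb t).2]) w hw
    rw [aux_const_sub hD ((βhi + lam) ^ 2) (fun t => (f t + lam) * (f t + lam)) (by fun_prop),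
      cfc_mul (fun t => f t + lam) (fun t => f t + lam) D (by fun_prop) (by fun_prop),
      ContinuousLinearMap.sub_apply,
      Algebra.algebraMap_eq_smul_one, ContinuousLinearMap.mul_apply,
      ContinuousLinearMap.smul_apply, ContinuousLinearMap.one_apply, ← Complex.coe_smul,
      inner_sub_right, inner_smul_right, ← hTdef, ← aux_symm hTs, hTc, aux_symm hD w w,
      aux_symm hD (T w), Complex.sub_re,
      Complex.re_ofReal_mul] at h
    linarith
  -- decompositions
  have dec : ∀ x : H, ∃ (b : ℂ) (w : H), x = b • ψ + w ∧ ⟪ψ, w⟫_ℂ = 0 := by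
    intro x
    refine ⟨⟪ψ, x⟫_ℂ, x - ⟪ψ, x⟫_ℂ • ψ, by abel, ?_⟩
    simp [inner_sub_right, inner_smul_right, hψ]
  have hDperp : ∀ w, ⟪ψ, w⟫_ℂ = 0 → ⟪ψ, D w⟫_ℂ = 0 := by
    intro w hw
    rw [← aux_symm hD, hDψ', inner_smul_left, hw, mul_zero]
  have perp' : ∀ w, ⟪ψ, w⟫_ℂ = 0 → ⟪w, ψ⟫_ℂ = 0 := fun w hw => inner_eq_zero_symm.mp hw
  obtain ⟨b, w, hx, hw⟩ := dec (Dinv u)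
  obtain ⟨c, p, hy, hp⟩ := dec (Dinv φ)
  have hu : u = D (b • ψ + w) := by rw [← hx, hDi]
  have hφ : φ = D (c • ψ + p) := by rw [← hy, hDi]
  have hc : (lamD : ℂ) * c = γ := by
    rw [← hφψ, hφ, map_add, map_smul, hDψ', inner_add_right, hDperp p hp, inner_smul_right,
      inner_smul_right, hψψ]
    ring
  have hφp : φ - (γ : ℂ) • ψ = D p := by
    rw [hφ, map_add, map_smul, hDψ', ← hc, smul_smul, mul_comm c]; abel
  rw [hφp, hiD, aux_symm hD] at hC₀
  -- constraint
  rw [← hTap, hφ, hTc, hiD, hu] at hconstraint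
  have hcon : (γ : ℂ) * ((s + lam : ℝ) : ℂ) * b = - ⟪T p, D w⟫_ℂ := by
    have hcc : (lamD : ℂ) * (starRingEnd ℂ) c = γ := by
      have := congrArg (starRingEnd ℂ) hc
      simpa using this
    rw [map_add, map_smul, hTψ, map_add, map_smul, hDψ'] at hconstraint
    simp only [inner_add_left, inner_add_right, inner_smul_left, inner_smul_right, hψψ,
      hDperp w hw, perp' _ (hTperp p hp), Complex.conj_ofReal] at hconstraint
    rw [← hcc]
    linear_combination hconstraint
  have hcs := aux_cs hD hpos (T p) w (hTperp p hp) hw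
  have hn : γ ^ 2 * (s + lam) ^ 2 * Complex.normSq b = Complex.normSq ⟪T p, D w⟫_ℂ := by
    rw [← Complex.normSq_neg ⟪T p, D w⟫_ℂ, ← hcon, Complex.normSq_mul, Complex.normSq_mul,
      Complex.normSq_ofReal, Complex.normSq_ofReal]
    ring
  -- target quantities
  have e1 : (⟪u, Dinv u⟫_ℂ).re = lamD * Complex.normSq b + (⟪w, D w⟫_ℂ).re := by
    rw [hx, hu, map_add, map_smul, hDψ', ← aux_symm hD w w]
    simp only [inner_add_left, inner_add_right, inner_smul_left, inner_smul_right, hψψ, hw,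
      perp' _ (hDperp w hw), Complex.conj_ofReal]
    have : (starRingEnd ℂ) b * (lamD * (b * 1)) = ((lamD * Complex.normSq b : ℝ) : ℂ) := by
      rw [Complex.ofReal_mul, ← Complex.mul_conj]; ring
    simp [Complex.normSq_apply]
    ring
  have e2 : (⟪u, S (Dinv u)⟫_ℂ).re = lamD * s * Complex.normSq b + (⟪D w, S w⟫_ℂ).re := by
    rw [hx, hu, map_add, map_smul, hDψ', map_add, map_smul, hSψ]
    simp only [inner_add_left, inner_add_right, inner_smul_left, inner_smul_right, hψψ,
      hSperp w hw,
      perp' _ (hDperp w hw), Complex.conj_ofReal]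
    simp [Complex.normSq_apply]
    ring
  rw [e1, e2]
  have hq := hpos w hw
  have hqp := hpos p hp
  have h1 := hSb w hw
  have h2 := hTb p hp
  have hN := Complex.normSq_nonneg b
  clear_value T S
  generalize (⟪w, D w⟫_ℂ).re = q at *
  generalize (⟪p, D p⟫_ℂ).re = r at *
  generalize (⟪D w, S w⟫_ℂ).re = m at *
  generalize Complex.normSq b = N at *
  have hl : 0 < βlo + lam := by linarith
  have h3 : γ ^ 2 * (βlo + lam) ^ 2 * N ≤ (βhi + lam) ^ 2 * r * q := by
    calc γ ^ 2 * (βlo + lam) ^ 2 * N ≤ γ ^ 2 * (s + lam) ^ 2 * N := by gcongr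
      _ ≤ _ := by rw [hn]; exact hcs.trans (mul_le_mul_of_nonneg_right h2 hq)
  have h4 : N ≤ C₀ * q := by
    have : C₀ * q = ((βhi + lam) ^ 2 * r * q) / (γ ^ 2 * (βlo + lam) ^ 2) := by
      rw [hC₀]; field_simp
    rw [this, le_div_iff₀ (by positivity)]
    linarith
  have h5 : -lamD * N ≤ q / 2 := by
    rw [abs_of_neg hlamD] at hsmall
    calc -lamD * N ≤ -lamD * (C₀ * q) := by
          apply mul_le_mul_of_nonneg_left h4; linarith
      _ = (-lamD * C₀) * q := by ring
      _ ≤ 1 / 2 * q := by gcongr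
      _ = q / 2 := by ring
  have hhi : 0 < βhi := by linarith
  have h6 : lamD * s * N ≤ 0 :=
    mul_nonpos_of_nonpos_of_nonneg
      (mul_nonpos_of_nonpos_of_nonneg hlamD.le (by linarith)) hN
  calc 1 / (2 * βhi) * (lamD * s * N + m) ≤ 1 / (2 * βhi) * (βhi * q) := by
        apply mul_le_mul_of_nonneg_left _ (by positivity); linarith
    _ = q / 2 := by field_simp
    _ ≤ _ := by linarith
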